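/- arXiv:2603.07179 — 2 statements merged into one kernel-verified Lean document; each statement's English description precedes it below -/
import Mathlib

section
/- Let X and Z be random variables taking values in finite nonempty sets 𝒳 and 𝒵 with joint probability mass function p, and let q(·|z) be, for each z ∈ 𝒵 with p(z) > 0, a probability mass function on 𝒳 satisfying q(x|z) > 0 whenever p(x,z) > 0. Then the mutual information decomposes exactly as I(X;Z) = Σ_{x,z} p(x,z) log( q(x|z) / p(x) ) + Σ_z p(z) · KL( p(·|z) ‖ q(·|z) ). Consequently, since Kullback–Leibler divergence is nonnegative, I(X;Z) ≥ Σ_{x,z} p(x,z) log( q(x|z) / p(x) ), i.e., the variational term is a lower bound on the mutual information for every choice of variational conditional distribution q. -/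
/-!
Statement 4: Barber–Agakov variational decomposition of mutual information.
For any variational conditional distribution `q(·|z)`,
`I(X;Z) = Σ_{x,z} p(x,z) log( q(x|z) / p(x) ) + Σ_z p(z) KL( p(·|z) ‖ q(·|z) )`,
and consequently `I(X;Z) ≥ Σ_{x,z} p(x,z) log( q(x|z) / p(x) )`.
-/

open scoped BigOperators

noncomputable section

variable {X Z : Type*} [Fintype X] [Fintype Z]

/-- Marginal pmf of `X`. -/
def margX (p : X → Z → ℝ) (x : X) : ℝ := ∑ z, p x z

/-- Marginal pmf of `Z`. -/
def margZ (p : X → Z → ℝ) (z : Z) : ℝ := ∑ x, p x z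

/-- Mutual information `I(X;Z) = Σ_{x,z} p(x,z) log( p(x,z) / (p(x) p(z)) )`. -/
def miXZ (p : X → Z → ℝ) : ℝ :=
  ∑ x, ∑ z, p x z * Real.log (p x z / (margX p x * margZ p z))

/-- Kullback–Leibler divergence `KL(P ‖ Q) = Σ_a P(a) log( P(a)/Q(a) )` between
pmfs on a finite set. -/
def klFin {α : Type*} [Fintype α] (P Q : α → ℝ) : ℝ :=
  ∑ a, P a * Real.log (P a / Q a)

/-- Gibbs inequality: the divergence of finitely supported weights is at least the difference
of their total masses. -/
theorem sum_sub_sum_le_klFin {α : Type*} [Fintype α] {P Q : α → ℝ}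
    (hP : ∀ a, 0 ≤ P a) (hQ : ∀ a, 0 ≤ Q a) (hPQ : ∀ a, 0 < P a → 0 < Q a) :
    ∑ a, P a - ∑ a, Q a ≤ klFin P Q := by
  rw [klFin, ← Finset.sum_sub_distrib]
  refine Finset.sum_le_sum fun a _ => ?_
  rcases (hP a).eq_or_lt with h | h
  · simpa [← h] using hQ a
  · have hlog := Real.one_sub_inv_le_log_of_pos (div_pos h (hPQ a h))
    calc P a - Q a = P a * (1 - (P a / Q a)⁻¹) := by field_simp
      _ ≤ P a * Real.log (P a / Q a) := mul_le_mul_of_nonneg_left hlog h.le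

theorem margX_pos {X Z : Type*} [Fintype Z] {p : X → Z → ℝ} (hp : ∀ x z, 0 ≤ p x z) {x : X} {z : Z} (h : 0 < p x z) :
    0 < margX p x :=
  h.trans_le (Finset.single_le_sum (fun z _ => hp x z) (Finset.mem_univ z))

theorem margZ_pos {X Z : Type*} [Fintype X] {p : X → Z → ℝ} (hp : ∀ x z, 0 ≤ p x z) {x : X} {z : Z} (h : 0 < p x z) :
    0 < margZ p z :=
  h.trans_le (Finset.single_le_sum (f := fun x => p x z) (fun x _ => hp x z) (Finset.mem_univ x))

theorem margZ_mul_klFin_nonneg {X Z : Type*} [Fintype X] {p : X → Z → ℝ}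
    (hp : ∀ x z, 0 ≤ p x z) {z : Z} {Q : X → ℝ}
    (hQ0 : 0 < margZ p z → ∀ x, 0 ≤ Q x) (hQ1 : 0 < margZ p z → ∑ x, Q x = 1)
    (hQpos : 0 < margZ p z → ∀ x, 0 < p x z → 0 < Q x) :
    0 ≤ margZ p z * klFin (fun x => p x z / margZ p z) Q := by
  have hm : 0 ≤ margZ p z := Finset.sum_nonneg fun x _ => hp x z
  rcases hm.eq_or_lt with h | h
  · simp [← h]
  · refine mul_nonneg hm ?_
    have hsum : ∑ x, p x z / margZ p z = 1 := by
      rw [← Finset.sum_div]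
      exact div_self h.ne'
    have key := sum_sub_sum_le_klFin (P := fun x => p x z / margZ p z) (Q := Q)
      (fun x => div_nonneg (hp x z) hm) (hQ0 h)
      (fun x hx => hQpos h x ((div_pos_iff_of_pos_right h).1 hx))
    rwa [hsum, hQ1 h, sub_self] at key

theorem mul_log_div_margX_mul_margZ {p : X → Z → ℝ} (hp : ∀ x z, 0 ≤ p x z) {x : X} {z : Z}
    {c : ℝ} (hc : 0 < p x z → 0 < c) :
    p x z * Real.log (p x z / (margX p x * margZ p z)) =
      p x z * Real.log (c / margX p x) +
        margZ p z * (p x z / margZ p z * Real.log (p x z / margZ p z / c)) := by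
  rcases (hp x z).eq_or_lt with h | h
  · simp [← h]
  · have hx := (margX_pos hp h).ne'
    have hz := (margZ_pos hp h).ne'
    have hc' := (hc h).ne'
    rw [← mul_assoc, mul_div_cancel₀ _ hz, ← mul_add,
      ← Real.log_mul (div_ne_zero hc' hx) (div_ne_zero (div_ne_zero h.ne' hz) hc')]
    congr 2
    field_simp

/-- Exact variational decomposition of mutual information and
the Barber–Agakov lower bound: for every variational conditional `q(·|z)`,
`I(X;Z) = Σ_{x,z} p(x,z) log(q(x|z)/p(x)) + Σ_z p(z) KL(p(·|z) ‖ q(·|z))`, and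
hence `Σ_{x,z} p(x,z) log(q(x|z)/p(x)) ≤ I(X;Z)`. -/
theorem mi_eq_variational_add_kl
    [Nonempty X] [Nonempty Z]
    (p : X → Z → ℝ)
    (hp : ∀ x z, 0 ≤ p x z)
    (hsum : ∑ x, ∑ z, p x z = 1)
    (q : Z → X → ℝ)
    (hq0 : ∀ z, 0 < margZ p z → ∀ x, 0 ≤ q z x)
    (hq1 : ∀ z, 0 < margZ p z → ∑ x, q z x = 1)
    (hqpos : ∀ z, 0 < margZ p z → ∀ x, 0 < p x z → 0 < q z x) :
    miXZ p =
      (∑ x, ∑ z, p x z * Real.log (q z x / margX p x)) +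
        ∑ z, margZ p z * klFin (fun x => p x z / margZ p z) (q z) ∧
    (∑ x, ∑ z, p x z * Real.log (q z x / margX p x)) ≤ miXZ p := by
  have decomp : miXZ p =
      (∑ x, ∑ z, p x z * Real.log (q z x / margX p x)) +
        ∑ z, margZ p z * klFin (fun x => p x z / margZ p z) (q z) := by
    simp only [miXZ, klFin, Finset.mul_sum]
    rw [Finset.sum_comm (s := (Finset.univ : Finset Z)), ← Finset.sum_add_distrib]
    refine Finset.sum_congr rfl fun x _ => ?_
    rw [← Finset.sum_add_distrib]
    exact Finset.sum_congr rfl fun z _ =>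
      mul_log_div_margX_mul_margZ hp fun h => hqpos z (margZ_pos hp h) x h
  refine ⟨decomp, ?_⟩
  rw [decomp]
  exact le_add_of_nonneg_right <| Finset.sum_nonneg fun z _ =>
    margZ_mul_klFin_nonneg hp (hq0 z) (hq1 z) (hqpos z)
end
end

section
/- Let (X₁,Z₁), …, (X_N,Z_N) be N independent pairs, each distributed according to a joint probability mass function p on the product of finite nonempty sets 𝒳 × 𝒵, and let f : 𝒳 × 𝒵 → ℝ be an arbitrary function (critic). Then the InfoNCE objective lower-bounds the mutual information of a single pair: E[ log( exp(f(X₁,Z₁)) / ( (1/N) Σ_{j=1}^{N} exp(f(X_j,Z₁)) ) ) ] ≤ I(X₁;Z₁). Equivalently, the negative InfoNCE loss −L_NCE is a lower bound on I(X;Z) for any choice of similarity/critic function. -/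
/-!
Statement 5: The InfoNCE objective lower-bounds mutual information.
For `N` i.i.d. pairs `(X₁,Z₁), …, (X_N,Z_N)` with common joint pmf `p` and any
critic `f : 𝒳 × 𝒵 → ℝ`,
`E[ log( exp(f(X₁,Z₁)) / ((1/N) Σ_j exp(f(X_j,Z₁))) ) ] ≤ I(X₁;Z₁)`.
-/

open scoped BigOperators

noncomputable section

variable {X Z : Type*} [Fintype X] [Fintype Z]

/-- A sum over functions of a product factors, also when one coordinate is weighted differently. -/
theorem sum_pi_prod_erase_mul {ι α : Type*} [Fintype ι] [DecidableEq ι] [Fintype α]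
    (i : ι) (P : ι → α → ℝ) (g : α → ℝ) :
    ∑ ω : ι → α, (∏ j ∈ Finset.univ.erase i, P j (ω j)) * g (ω i) =
      (∏ j ∈ Finset.univ.erase i, ∑ a, P j a) * ∑ a, g a := by
  have h := Fintype.prod_sum (Function.update P i g)
  rw [← Finset.prod_erase_mul _ _ (Finset.mem_univ i), Function.update_self] at h
  rw [Finset.prod_congr rfl fun j hj => by
    rw [← Function.update_of_ne (Finset.ne_of_mem_erase hj) g P], h]
  refine Finset.sum_congr rfl fun ω _ => ?_
  rw [← Finset.prod_erase_mul _ _ (Finset.mem_univ i), Function.update_self]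
  congr 1
  refine Finset.prod_congr rfl fun j hj => ?_
  rw [Function.update_of_ne (Finset.ne_of_mem_erase hj)]

/-- Among i.i.d. samples, the normalized score of each sample has the same mean, namely one. -/
theorem sum_pi_prod_mul_normalized {ι α : Type*} [Fintype ι] [DecidableEq ι] [Fintype α]
    (i : ι) (q e : α → ℝ) (hq : ∑ a, q a = 1) (he : ∀ a, 0 < e a) :
    ∑ x : ι → α, (∏ j, q (x j)) *
      (e (x i) / (1 / (Fintype.card ι : ℝ) * ∑ j, e (x j))) = 1 := by
  have hsymm : ∀ k : ι, ∑ x : ι → α, (∏ j, q (x j)) *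
      (e (x k) / (1 / (Fintype.card ι : ℝ) * ∑ j, e (x j))) =
      ∑ x : ι → α, (∏ j, q (x j)) *
      (e (x i) / (1 / (Fintype.card ι : ℝ) * ∑ j, e (x j))) := by
    intro k
    refine Fintype.sum_equiv ((Equiv.swap i k).arrowCongr (Equiv.refl α)) _ _ fun x => ?_
    have hs := Equiv.sum_comp (Equiv.swap i k) fun j => e (x j)
    have hp := Equiv.prod_comp (Equiv.swap i k) fun j => q (x j)
    simp [Equiv.arrowCongr, hs, hp]
  have hpos : (0 : ℝ) < Fintype.card ι := by
    have : Nonempty ι := ⟨i⟩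
    exact_mod_cast Fintype.card_pos
  have htotal : ∑ k : ι, ∑ x : ι → α, (∏ j, q (x j)) *
      (e (x k) / (1 / (Fintype.card ι : ℝ) * ∑ j, e (x j))) = Fintype.card ι := by
    rw [Finset.sum_comm]
    have hx : ∀ x : ι → α, ∑ k, (∏ j, q (x j)) *
        (e (x k) / (1 / (Fintype.card ι : ℝ) * ∑ j, e (x j))) =
        (∏ j, q (x j)) * Fintype.card ι := by
      intro x
      have : 0 < ∑ j, e (x j) := Finset.sum_pos (fun j _ => he _) ⟨i, Finset.mem_univ i⟩
      rw [← Finset.mul_sum, ← Finset.sum_div]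
      congr 1
      field_simp
    rw [Finset.sum_congr rfl fun x _ => hx x, ← Finset.sum_mul,
      ← Fintype.prod_sum fun (_ : ι) a => q a]
    simp [hq]
  rw [Finset.sum_congr rfl fun k _ => hsymm k] at htotal
  simp only [Finset.sum_const, Finset.card_univ, nsmul_eq_mul] at htotal
  exact mul_left_cancel₀ hpos.ne' (htotal.trans (mul_one _).symm)

/-- The inequality `log t ≤ t - 1` at `t = b * r / a`, in a form valid also at `a = 0`. -/
theorem mul_log_le_mul_log_div_add {a b r : ℝ} (ha : 0 ≤ a) (hb : 0 ≤ b)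
    (hab : b = 0 → a = 0) (hr : 0 < r) :
    a * Real.log r ≤ a * Real.log (a / b) + (b * r - a) := by
  rcases ha.eq_or_lt with rfl | ha
  · simpa using mul_nonneg hb hr.le
  have hb : 0 < b := hb.lt_of_ne fun h => ha.ne' (hab h.symm)
  have h := mul_le_mul_of_nonneg_left
    (Real.log_le_sub_one_of_pos (div_pos (mul_pos hb hr) ha)) ha.le
  rw [Real.log_div (by positivity) ha.ne', Real.log_mul hb.ne' hr.ne', mul_sub a (_ / a),
    mul_div_cancel₀ _ ha.ne'] at h
  rw [Real.log_div ha.ne' hb.ne']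
  linarith

/-- Under the product of the marginals of the positive pair, the normalized score has mean one. -/
theorem sum_marginals_mul_normalized {ι : Type*} [Fintype ι] [DecidableEq ι] (i : ι)
    (p : X → Z → ℝ) (hsum : ∑ x, ∑ z, p x z = 1) (f : X → Z → ℝ) :
    ∑ ω : ι → X × Z, (∏ j ∈ Finset.univ.erase i, p (ω j).1 (ω j).2) *
      (margX p (ω i).1 * margZ p (ω i).2 * (Real.exp (f (ω i).1 (ω i).2) /
        (1 / (Fintype.card ι : ℝ) * ∑ j, Real.exp (f (ω j).1 (ω i).2)))) = 1 := by
  have hZ : ∑ z, margZ p z = 1 := by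
    simp only [margZ]
    rw [Finset.sum_comm, hsum]
  calc _ = ∑ x : ι → X, ∑ y : ι → Z, (∏ j ∈ Finset.univ.erase i, p (x j) (y j)) *
        (margX p (x i) * margZ p (y i) * (Real.exp (f (x i) (y i)) /
          (1 / (Fintype.card ι : ℝ) * ∑ j, Real.exp (f (x j) (y i))))) := by
        rw [← Fintype.sum_prod_type']
        exact Fintype.sum_equiv (Equiv.arrowProdEquivProdArrow ι (fun _ => X) (fun _ => Z)) _ _
          fun ω => rfl
    _ = ∑ x : ι → X, ∑ z, margZ p z * ((∏ j, margX p (x j)) * (Real.exp (f (x i) z) /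
          (1 / (Fintype.card ι : ℝ) * ∑ j, Real.exp (f (x j) z)))) := by
        refine Finset.sum_congr rfl fun x _ => ?_
        rw [sum_pi_prod_erase_mul i (fun j z => p (x j) z) fun z =>
          margX p (x i) * margZ p z * (Real.exp (f (x i) z) /
            (1 / (Fintype.card ι : ℝ) * ∑ j, Real.exp (f (x j) z))), Finset.mul_sum]
        refine Finset.sum_congr rfl fun z _ => ?_
        rw [← Finset.prod_erase_mul _ _ (Finset.mem_univ i)]
        simp only [margX]
        ring
    _ = 1 := by
        rw [Finset.sum_comm]
        simp only [← Finset.mul_sum]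
        rw [Finset.sum_congr rfl fun z _ => by
          rw [sum_pi_prod_mul_normalized i (margX p) (fun x => Real.exp (f x z)) hsum
            fun _ => Real.exp_pos _]]
        simpa using hZ

/-- InfoNCE bound: the expectation (over `N` i.i.d. pairs
`ω j = (X_j, Z_j)`, with joint pmf `∏ j, p (ω j)`) of
`log( exp(f(X₁,Z₁)) / ((1/N) Σ_j exp(f(X_j,Z₁))) )` is at most `I(X;Z)`,
for every critic `f`. -/
theorem infoNCE_le_mi
    [Nonempty X] [Nonempty Z]
    (p : X → Z → ℝ)
    (hp : ∀ x z, 0 ≤ p x z)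
    (hsum : ∑ x, ∑ z, p x z = 1)
    (N : ℕ) (hN : 0 < N)
    (f : X → Z → ℝ) :
    (∑ ω : Fin N → X × Z,
        (∏ j, p (ω j).1 (ω j).2) *
          Real.log (Real.exp (f (ω ⟨0, hN⟩).1 (ω ⟨0, hN⟩).2) /
            ((1 / (N : ℝ)) * ∑ j, Real.exp (f (ω j).1 (ω ⟨0, hN⟩).2)))) ≤
      miXZ p := by
  classical
  set i : Fin N := ⟨0, hN⟩
  have hmX : ∀ x, 0 ≤ margX p x := fun x => Finset.sum_nonneg fun z _ => hp x z
  have hmZ : ∀ z, 0 ≤ margZ p z := fun z => Finset.sum_nonneg fun x _ => hp x z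
  have hzero : ∀ x z, margX p x * margZ p z = 0 → p x z = 0 := by
    intro x z h
    rcases mul_eq_zero.mp h with h | h
    · exact (Finset.sum_eq_zero_iff_of_nonneg fun z _ => hp x z).mp h z (Finset.mem_univ z)
    · exact (Finset.sum_eq_zero_iff_of_nonneg fun x _ => hp x z).mp h x (Finset.mem_univ x)
  have hsum' : ∑ a : X × Z, p a.1 a.2 = 1 := by rw [Fintype.sum_prod_type, hsum]
  have hmarg : ∀ g : X × Z → ℝ,
      ∑ ω : Fin N → X × Z, (∏ j ∈ Finset.univ.erase i, p (ω j).1 (ω j).2) * g (ω i) =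
        ∑ a, g a := by
    intro g
    rw [sum_pi_prod_erase_mul i (fun _ a => p a.1 a.2) g]
    simp [hsum']
  have hmi := hmarg fun a => p a.1 a.2 * Real.log (p a.1 a.2 / (margX p a.1 * margZ p a.2))
  rw [Fintype.sum_prod_type] at hmi
  have hone := hmarg fun a => p a.1 a.2
  rw [hsum'] at hone
  have hnorm := sum_marginals_mul_normalized i p hsum f
  rw [Fintype.card_fin] at hnorm
  rw [← add_zero (miXZ p), ← sub_eq_zero.mpr (hnorm.trans hone.symm), miXZ, ← hmi,
    ← Finset.sum_sub_distrib, ← Finset.sum_add_distrib]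
  refine Finset.sum_le_sum fun ω _ => ?_
  rw [← Finset.prod_erase_mul _ _ (Finset.mem_univ i), mul_assoc, ← mul_sub, ← mul_add]
  refine mul_le_mul_of_nonneg_left ?_ (Finset.prod_nonneg fun j _ => hp _ _)
  refine mul_log_le_mul_log_div_add (hp _ _) (mul_nonneg (hmX _) (hmZ _)) (hzero _ _) ?_
  have hNpos : (0 : ℝ) < N := by exact_mod_cast hN
  have hS : 0 < ∑ j, Real.exp (f (ω j).1 (ω i).2) :=
    Finset.sum_pos (fun _ _ => Real.exp_pos _) ⟨i, Finset.mem_univ i⟩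
  positivity
end
end
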